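/- arXiv:1804.07197 — 3 statements merged into one kernel-verified Lean document; each statement's English description precedes it below -/
import Mathlib

section
/- For every real-valued continuously differentiable function u on ℝ³ whose support is compact and contained in Ω, every ε with 0 < ε < 1, and every Λ ≥ 0, one has ∫_{ℝ³} (|∇u|² − Λ|u|²) dx ≥ (1−ε) ∫_{ℝ³} |∇u|² dx − ∫_{ℝ³} (ε f(x₁) − Λ)₋ |u(x₁,x₂,x₃)|² dx₁dx₂dx₃. (The quadratic-form inequality (Lieb-Thirring) in the proof of Theorem 2.1.) -/
open Real Set Filter MeasureTheory

lemma qf_one_dim (θ θ' K f g v : ℝ → ℝ) (φ ε : ℝ) (hε : 0 ≤ ε)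
    (hθ : ∀ x, HasDerivAt θ (θ' x) x) (hθ'c : Continuous θ')
    (hKloc : ∀ x, 0 < Real.cos (θ x + φ) → ∀ᶠ y in nhds x, K y = K x)
    (hKf : ∀ x, 0 < Real.cos (θ x + φ) → f x ≤ K x ^ 2)
    (hKθ : ∀ x, 0 < Real.cos (θ x + φ) → K x ^ 2 ≤ K x * θ' x)
    (hv : ContDiff ℝ 1 v) (hvc : HasCompactSupport v)
    (hvs : ∀ x ∈ tsupport v, 0 < Real.cos (θ x + φ))
    (hg : ∀ x, g x ≤ ε * f x) (hgi : Integrable (fun x => g x * v x ^ 2)) :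
    0 ≤ ∫ x, (ε * deriv v x ^ 2 - g x * v x ^ 2) := by
  have hθc : ContDiff ℝ 1 θ := by
    rw [contDiff_one_iff_deriv]
    refine ⟨fun x => (hθ x).differentiableAt, ?_⟩
    have : deriv θ = θ' := funext fun x => (hθ x).deriv
    rwa [this]
  let F : ℝ → ℝ := fun x => - K x * Real.tan (θ x + φ) * v x ^ 2
  have hFz : ∀ x, x ∉ tsupport v → F =ᶠ[nhds x] fun _ => 0 := by
    intro x hx
    have := notMem_tsupport_iff_eventuallyEq.1 hx
    filter_upwards [this] with y hy
    simp [F, hy]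
  have hFl : ∀ x, x ∈ tsupport v →
      F =ᶠ[nhds x] fun y => - K x * Real.tan (θ y + φ) * v y ^ 2 := by
    intro x hx
    filter_upwards [hKloc x (hvs x hx)] with y hy
    simp [F, hy]
  have hF : ContDiff ℝ 1 F := by
    rw [contDiff_iff_contDiffAt]
    intro x
    by_cases hx : x ∈ tsupport v
    · refine ContDiffAt.congr_of_eventuallyEq ?_ (hFl x hx)
      have h1 : ContDiffAt ℝ 1 (fun y => Real.tan (θ y + φ)) x :=
        ContDiffAt.comp x (f := fun y => θ y + φ) (g := Real.tan)
          (Real.contDiffAt_tan.2 (hvs x hx).ne') (hθc.contDiffAt.add contDiffAt_const)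
      exact (contDiffAt_const.mul h1).mul (hv.contDiffAt.pow 2)
    · exact ContDiffAt.congr_of_eventuallyEq contDiffAt_const (hFz x hx)
  have hFc : HasCompactSupport F := by
    refine HasCompactSupport.intro hvc fun x hx => (hFz x hx).eq_of_nhds
  have hFi : Integrable (deriv F) :=
    (hF.continuous_deriv le_rfl).integrable_of_hasCompactSupport hFc.deriv
  have hF0 : ∫ x, deriv F x = 0 :=
    integral_eq_zero_of_hasDerivAt_of_integrable
      (fun x => (hF.differentiable one_ne_zero x).hasDerivAt) hFi
      (hF.continuous.integrable_of_hasCompactSupport hFc)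
  have hvi : Integrable (fun x => ε * deriv v x ^ 2) := by
    have hc : Continuous (fun x => ε * deriv v x ^ 2) :=
      continuous_const.mul ((hv.continuous_deriv le_rfl).pow 2)
    refine hc.integrable_of_hasCompactSupport (HasCompactSupport.intro hvc.deriv ?_)
    intro x hx
    simp [image_eq_zero_of_notMem_tsupport hx]
  have key : ∫ x, ε * deriv F x ≤ ∫ x, (ε * deriv v x ^ 2 - g x * v x ^ 2) := by
    refine integral_mono (hFi.const_mul ε) (hvi.sub hgi) fun x => ?_
    have hgx : g x * v x ^ 2 ≤ ε * f x * v x ^ 2 :=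
      mul_le_mul_of_nonneg_right (hg x) (sq_nonneg _)
    suffices h : deriv F x + f x * v x ^ 2 ≤ deriv v x ^ 2 by
      have := mul_le_mul_of_nonneg_left h hε
      simp only
      linarith
    by_cases hx : x ∈ tsupport v
    · have hc := hvs x hx
      have h1 : HasDerivAt (fun y => Real.tan (θ y + φ))
          (1 / Real.cos (θ x + φ) ^ 2 * θ' x) x :=
        HasDerivAt.comp x (h₂ := Real.tan) (h := fun y => θ y + φ)
          (Real.hasDerivAt_tan hc.ne') ((hθ x).add_const φ)
      have h2 : HasDerivAt v (deriv v x) x := (hv.differentiable one_ne_zero x).hasDerivAt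
      have h3 := ((h1.const_mul (-K x)).mul (h2.pow 2)).congr_of_eventuallyEq (hFl x hx)
      rw [h3.deriv]
      have hs : 1 / Real.cos (θ x + φ) ^ 2 = 1 + Real.tan (θ x + φ) ^ 2 := by
        rw [Real.tan_eq_sin_div_cos]
        field_simp
        linarith [Real.sin_sq_add_cos_sq (θ x + φ)]
      rw [hs]
      set T := Real.tan (θ x + φ)
      have a1 := hKf x hc
      have a2 := hKθ x hc
      have a3 : (K x * θ' x - K x ^ 2) * ((1 + T ^ 2) * v x ^ 2) ≥ 0 :=
        mul_nonneg (by linarith) (by positivity)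
      have a4 : (K x ^ 2 - f x) * v x ^ 2 ≥ 0 := mul_nonneg (by linarith) (by positivity)
      have a5 := sq_nonneg (deriv v x + K x * T * v x)
      norm_num
      nlinarith
    · rw [(hFz x hx).deriv_eq, image_eq_zero_of_notMem_tsupport hx]
      simp
      positivity
  rwa [integral_const_mul, hF0, mul_zero] at key

/-- The quadratic-form inequality (Lieb-Thirring) in the proof of Theorem 2.1: for every
continuously differentiable `u : ℝ³ → ℝ` with compact support contained in the twisted tube
`Ω`, every `0 < ε < 1` and every `Λ ≥ 0`,
`∫ (|∇u|² − Λ|u|²) ≥ (1−ε) ∫ |∇u|² − ∫ (ε f(x₁) − Λ)₋ |u|²`,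
where `|∇u|²` is the sum of the squares of the three partial derivatives and
`(z)₋ = max(−z,0)`. -/
theorem quadratic_form_inequality
    (ω : Set (ℝ × ℝ)) (hω_ne : ω.Nonempty) (hω_bdd : Bornology.IsBounded ω)
    (hω_open : IsOpen ω) (hω_conn : IsConnected ω)
    (hω_half : ω ⊆ {y : ℝ × ℝ | 0 < y.1})
    (θ θ' : ℝ → ℝ)
    (hθ : ∀ x, HasDerivAt θ (θ' x) x) (hθ'c : Continuous θ')
    (hmono : Monotone θ')
    (hpos : ∀ x, 0 ≤ x → 0 ≤ θ' x) (hneg : ∀ x, x ≤ 0 → θ' x ≤ 0)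
    (hinf : Tendsto (fun x => |θ' x|) (cocompact ℝ) atTop)
    (Ω : Set (ℝ × ℝ × ℝ))
    (hΩ : Ω = (fun q : ℝ × ℝ × ℝ =>
      (q.1, q.2.1 * Real.cos (θ q.1) + q.2.2 * Real.sin (θ q.1),
       q.2.2 * Real.cos (θ q.1) - q.2.1 * Real.sin (θ q.1))) '' (Set.univ ×ˢ ω))
    (θinvp θinvm : ℝ → ℝ)
    (hinvp : ∀ α, θ 0 ≤ α →
      0 ≤ θinvp α ∧ θ (θinvp α) = α ∧ ∀ z, 0 ≤ z → θ z = α → θinvp α ≤ z)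
    (hinvm : ∀ α, θ 0 ≤ α →
      θinvm α ≤ 0 ∧ θ (θinvm α) = α ∧ ∀ z, z ≤ 0 → θ z = α → z ≤ θinvm α)
    (f : ℝ → ℝ)
    (hf₁ : ∀ x, θinvp (θ 0 + 2 * π) ≤ x → f x = (θ' (θinvp (θ x - π))) ^ 2)
    (hf₂ : ∀ x, x ≤ θinvm (θ 0 + 2 * π) → f x = (θ' (θinvm (θ x - π))) ^ 2)
    (hf₃ : ∀ x, θinvm (θ 0 + 2 * π) < x → x < θinvp (θ 0 + 2 * π) → f x = 0)
    (u : ℝ × ℝ × ℝ → ℝ)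
    (hu : ContDiff ℝ 1 u)
    (husupp : HasCompactSupport u)
    (huΩ : tsupport u ⊆ Ω)
    (ε Λ : ℝ) (hε₀ : 0 < ε) (hε₁ : ε < 1) (hΛ : 0 ≤ Λ) :
    (1 - ε) * (∫ p : ℝ × ℝ × ℝ,
        ((deriv (fun t => u (t, p.2)) p.1) ^ 2 +
         (deriv (fun t => u (p.1, t, p.2.2)) p.2.1) ^ 2 +
         (deriv (fun t => u (p.1, p.2.1, t)) p.2.2) ^ 2)) -
      (∫ p : ℝ × ℝ × ℝ, (max (-(ε * f p.1 - Λ)) 0) * (u p) ^ 2) ≤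
    ∫ p : ℝ × ℝ × ℝ,
        (((deriv (fun t => u (t, p.2)) p.1) ^ 2 +
          (deriv (fun t => u (p.1, t, p.2.2)) p.2.1) ^ 2 +
          (deriv (fun t => u (p.1, p.2.1, t)) p.2.2) ^ 2) - Λ * (u p) ^ 2) := by
  have hθd : Differentiable ℝ θ := fun x => (hθ x).differentiableAt
  have hθcont : Continuous θ := hθd.continuous
  have mp : MonotoneOn θ (Ici 0) := by
    refine monotoneOn_of_deriv_nonneg (convex_Ici 0) hθcont.continuousOn
      hθd.differentiableOn fun x hx => ?_
    rw [interior_Ici] at hx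
    rw [(hθ x).deriv]
    exact hpos x (le_of_lt hx)
  have mm : AntitoneOn θ (Iic 0) := by
    refine antitoneOn_of_deriv_nonpos (convex_Iic 0) hθcont.continuousOn
      hθd.differentiableOn fun x hx => ?_
    rw [interior_Iic] at hx
    rw [(hθ x).deriv]
    exact hneg x (le_of_lt hx)
  have hpi := Real.pi_pos
  have invp_lt : ∀ α x, θ 0 ≤ α → 0 ≤ x → α < θ x → θinvp α < x := by
    intro α x hα hx h
    by_contra! hc
    have := mp hx (hx.trans hc) hc
    rw [(hinvp α hα).2.1] at this
    linarith
  have invm_lt : ∀ α x, θ 0 ≤ α → x ≤ 0 → α < θ x → x < θinvm α := by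
    intro α x hα hx h
    by_contra! hc
    have := mm (show θinvm α ∈ Iic 0 from hc.trans hx) hx hc
    rw [(hinvm α hα).2.1] at this
    linarith
  have invp_mono : ∀ α β, θ 0 ≤ α → α ≤ β → θinvp α ≤ θinvp β := by
    intro α β hα h
    rcases h.eq_or_lt with rfl | h
    · exact le_rfl
    · have hb := hinvp β (by linarith)
      exact (invp_lt α _ hα hb.1 (by rw [hb.2.1]; exact h)).le
  have invm_mono : ∀ α β, θ 0 ≤ α → α ≤ β → θinvm β ≤ θinvm α := by
    intro α β hα h
    rcases h.eq_or_lt with rfl | h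
    · exact le_rfl
    · have hb := hinvm β (by linarith)
      exact (invm_lt α _ hα hb.1 (by rw [hb.2.1]; exact h)).le
  obtain ⟨hXp0, hXp, -⟩ := hinvp (θ 0 + 2 * π) (by linarith)
  obtain ⟨hXm0, hXm, -⟩ := hinvm (θ 0 + 2 * π) (by linarith)
  have hXp1 : ∀ x, θinvp (θ 0 + 2 * π) ≤ x → θ 0 + 2 * π ≤ θ x := by
    intro x hx
    have := mp hXp0 (hXp0.trans hx) hx
    rwa [hXp] at this
  have hXm1 : ∀ x, x ≤ θinvm (θ 0 + 2 * π) → θ 0 + 2 * π ≤ θ x := by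
    intro x hx
    have := mm (show x ∈ Iic 0 from hx.trans hXm0) hXm0 hx
    rwa [hXm] at this
  have hXp2 : 0 < θinvp (θ 0 + 2 * π) := by
    by_contra! h
    have := hXp1 0 h
    linarith
  have hXm2 : θinvm (θ 0 + 2 * π) < 0 := by
    by_contra! h
    have := hXm1 0 h
    linarith
  have hf0 : ∀ x, 0 ≤ f x := by
    intro x
    rcases le_or_gt (θinvp (θ 0 + 2 * π)) x with h | h
    · rw [hf₁ x h]; positivity
    · rcases le_or_gt x (θinvm (θ 0 + 2 * π)) with h' | h'
      · rw [hf₂ x h']; positivity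
      · rw [hf₃ x h' h]
  have hfp : Monotone (fun x => f (max x 0)) := by
    intro x y hxy
    have hxy' : max x 0 ≤ max y 0 := max_le_max hxy le_rfl
    have hx0 : 0 ≤ max x 0 := le_max_right _ _
    have hy0 : 0 ≤ max y 0 := le_max_right _ _
    simp only
    generalize max x 0 = a at *
    generalize max y 0 = b at *
    rcases le_or_gt (θinvp (θ 0 + 2 * π)) a with h | h
    · rw [hf₁ a h, hf₁ b (h.trans hxy')]
      have h1 := hXp1 a h
      have h2 := mp hx0 hy0 hxy'
      have h3 := hinvp (θ a - π) (by linarith)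
      exact pow_le_pow_left₀ (hpos _ h3.1) (hmono (invp_mono _ _ (by linarith) (by linarith))) 2
    · rw [hf₃ a (by linarith) h]; exact hf0 b
  have hfm : Antitone (fun x => f (min x 0)) := by
    intro y x hxy
    have hxy' : min y 0 ≤ min x 0 := min_le_min hxy le_rfl
    have hx0 : min x 0 ≤ 0 := min_le_right _ _
    have hy0 : min y 0 ≤ 0 := min_le_right _ _
    simp only
    generalize min x 0 = a at *
    generalize min y 0 = b at *
    rcases le_or_gt a (θinvm (θ 0 + 2 * π)) with h | h
    · rw [hf₂ a h, hf₂ b (hxy'.trans h)]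
      have h1 := hXm1 a h
      have h2 := mm hy0 hx0 hxy'
      have h3 := hinvm (θ a - π) (by linarith)
      have h4 := hneg _ h3.1
      have h5 := hmono (invm_mono (θ a - π) (θ b - π) (by linarith) (by linarith))
      nlinarith
    · rw [hf₃ a h (by linarith)]; exact hf0 b
  have hfmeas : Measurable f := by
    have : f = fun x => if 0 ≤ x then f (max x 0) else f (min x 0) := by
      funext x
      split_ifs with h
      · rw [max_eq_left h]
      · rw [min_eq_left (by linarith)]
    rw [this]
    exact Measurable.ite measurableSet_Ici hfp.measurable hfm.measurable
  -- the one-dimensional inequality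
  have one : ∀ (φ : ℝ) (g v : ℝ → ℝ), ContDiff ℝ 1 v → HasCompactSupport v →
      (∀ x ∈ tsupport v, 0 < Real.cos (θ x + φ)) → (∀ x, g x ≤ ε * f x) →
      Integrable (fun x => g x * v x ^ 2) →
      0 ≤ ∫ x, (ε * deriv v x ^ 2 - g x * v x ^ 2) := by
    intro φ g v hv hvc hvs hg hgi
    let N : ℝ → ℤ := fun x => ⌊(θ x + φ) / π + 1 / 2⌋
    let A : ℤ → ℝ := fun n => n * π - π / 2 - φ
    have hA1 : ∀ x, A (N x) ≤ θ x := by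
      intro x
      have h : ((N x : ℤ) : ℝ) ≤ (θ x + φ) / π + 1 / 2 := Int.floor_le _
      have h2 := mul_le_mul_of_nonneg_right h hpi.le
      have h3 : ((θ x + φ) / π + 1 / 2) * π = θ x + φ + π / 2 := by field_simp
      simp only [A]; linarith
    have hA2 : ∀ x, θ x < A (N x) + π := by
      intro x
      have h : (θ x + φ) / π + 1 / 2 < (N x : ℤ) + 1 := Int.lt_floor_add_one _
      have h2 := mul_lt_mul_of_pos_right h hpi
      have h3 : ((θ x + φ) / π + 1 / 2) * π = θ x + φ + π / 2 := by field_simp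
      simp only [A]; linarith
    have hA3 : ∀ x, 0 < Real.cos (θ x + φ) → A (N x) < θ x := by
      intro x hx
      refine lt_of_le_of_ne (hA1 x) fun h => ?_
      have h2 : θ x + φ = N x * π - π / 2 := by rw [← h]; simp only [A]; ring
      rw [h2, Real.cos_sub_pi_div_two, Real.sin_int_mul_pi] at hx
      exact lt_irrefl _ hx
    have hNloc : ∀ x, 0 < Real.cos (θ x + φ) → ∀ᶠ y in nhds x, N y = N x := by
      intro x hx
      have e1 := hθcont.continuousAt.eventually (lt_mem_nhds (hA3 x hx))
      have e2 := hθcont.continuousAt.eventually (gt_mem_nhds (hA2 x))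
      filter_upwards [e1, e2] with y h1 h2
      have h3 : ((θ y + φ) / π + 1 / 2) * π = θ y + φ + π / 2 := by field_simp
      simp only [A] at h1 h2
      refine Int.floor_eq_iff.2 ⟨?_, ?_⟩
      · refine le_of_mul_le_mul_right ?_ hpi
        linarith
      · refine lt_of_mul_lt_mul_right ?_ hpi.le
        linarith
    let K : ℝ → ℝ := fun x => if A (N x) < θ 0 then 0 else
      if 0 ≤ x then θ' (θinvp (A (N x))) else θ' (θinvm (A (N x)))
    refine qf_one_dim θ θ' K f g v φ ε hε₀.le hθ hθ'c ?_ ?_ ?_ hv hvc hvs hg hgi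
    · intro x hx
      by_cases h : A (N x) < θ 0
      · filter_upwards [hNloc x hx] with y hy
        simp only [K, hy, if_pos h]
      · rcases lt_trichotomy x 0 with h0 | h0 | h0
        · filter_upwards [hNloc x hx, gt_mem_nhds h0] with y hy hy0
          simp only [K, hy, if_neg (not_le.2 h0), if_neg (not_le.2 hy0)]
        · have := hA3 x hx
          rw [h0] at this h
          exact absurd this h
        · filter_upwards [hNloc x hx, lt_mem_nhds h0] with y hy hy0
          simp only [K, hy, if_pos h0.le, if_pos (le_of_lt hy0)]
    · intro x hx
      have a2 := hA2 x
      have a3 := hA3 x hx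
      rcases le_or_gt (θinvp (θ 0 + 2 * π)) x with h | h
      · have h1 := hXp1 x h
        have h2 : ¬ (A (N x) < θ 0) := by linarith
        simp only [K, if_neg h2, if_pos (hXp0.trans h)]
        rw [hf₁ x h]
        have h3 := hinvp (θ x - π) (by linarith)
        exact pow_le_pow_left₀ (hpos _ h3.1)
          (hmono (invp_mono _ _ (by linarith) (by linarith))) 2
      · rcases le_or_gt x (θinvm (θ 0 + 2 * π)) with h' | h'
        · have h1 := hXm1 x h'
          have h2 : ¬ (A (N x) < θ 0) := by linarith
          have h6 : ¬ (0 ≤ x) := by linarith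
          simp only [K, if_neg h2, if_neg h6]
          rw [hf₂ x h']
          have h3 := hinvm (θ x - π) (by linarith)
          have h4 := hneg _ h3.1
          have h5 := hmono (invm_mono (θ x - π) (A (N x)) (by linarith) (by linarith))
          nlinarith
        · rw [hf₃ x h' h]; positivity
    · intro x hx
      have a3 := hA3 x hx
      by_cases h2 : A (N x) < θ 0
      · simp only [K, if_pos h2]; norm_num
      · have h2' := not_lt.1 h2
        by_cases h0 : 0 ≤ x
        · simp only [K, if_neg h2, if_pos h0]
          have h3 := hmono (invp_lt _ x h2' h0 a3).le
          have h4 := hpos _ (hinvp _ h2').1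
          nlinarith
        · simp only [K, if_neg h2, if_neg h0]
          have h3 := hmono (invm_lt _ x h2' (by linarith) a3).le
          have h4 := hneg _ (hinvm _ h2').1
          nlinarith
  -- partial derivatives
  have hud : Differentiable ℝ u := hu.differentiable one_ne_zero
  have d1 : ∀ p : ℝ × ℝ × ℝ, deriv (fun t => u (t, p.2)) p.1 = fderiv ℝ u p (1, 0, 0) := by
    intro p
    have h : HasDerivAt (fun t : ℝ => (t, p.2)) ((1 : ℝ), (0 : ℝ × ℝ)) p.1 :=
      (hasDerivAt_id _).prodMk (hasDerivAt_const _ _)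
    exact ((hud p).hasFDerivAt.comp_hasDerivAt p.1 h).deriv
  have d2 : ∀ p : ℝ × ℝ × ℝ,
      deriv (fun t => u (p.1, t, p.2.2)) p.2.1 = fderiv ℝ u p (0, 1, 0) := by
    intro p
    have h : HasDerivAt (fun t : ℝ => (p.1, t, p.2.2)) ((0 : ℝ), (1 : ℝ), (0 : ℝ)) p.2.1 :=
      (hasDerivAt_const _ _).prodMk ((hasDerivAt_id _).prodMk (hasDerivAt_const _ _))
    exact ((hud p).hasFDerivAt.comp_hasDerivAt p.2.1 h).deriv
  have d3 : ∀ p : ℝ × ℝ × ℝ,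
      deriv (fun t => u (p.1, p.2.1, t)) p.2.2 = fderiv ℝ u p (0, 0, 1) := by
    intro p
    have h : HasDerivAt (fun t : ℝ => (p.1, p.2.1, t)) ((0 : ℝ), (0 : ℝ), (1 : ℝ)) p.2.2 :=
      (hasDerivAt_const _ _).prodMk ((hasDerivAt_const _ _).prodMk (hasDerivAt_id _))
    exact ((hud p).hasFDerivAt.comp_hasDerivAt p.2.2 h).deriv
  have di : ∀ w : ℝ × ℝ × ℝ, Integrable (fun p => (fderiv ℝ u p w) ^ 2) := by
    intro w
    have hc : Continuous (fun p => (fderiv ℝ u p w) ^ 2) :=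
      ((hu.continuous_fderiv one_ne_zero).clm_apply continuous_const).pow 2
    refine hc.integrable_of_hasCompactSupport
      (HasCompactSupport.intro (husupp.fderiv (𝕜 := ℝ)) fun x hx => ?_)
    simp [image_eq_zero_of_notMem_tsupport hx]
  have hui : Integrable (fun p => u p ^ 2) := by
    refine (hu.continuous.pow 2).integrable_of_hasCompactSupport
      (HasCompactSupport.intro husupp fun x hx => ?_)
    simp [image_eq_zero_of_notMem_tsupport hx]
  let M : ℝ → ℝ := fun x => max (-(ε * f x - Λ)) 0
  have hMmeas : Measurable M := by
    exact ((hfmeas.const_mul ε).sub_const Λ).neg.max measurable_const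
  have hM0 : ∀ x, 0 ≤ M x := fun x => le_max_right _ _
  have hM1 : ∀ x, M x ≤ Λ := fun x =>
    max_le (by have := mul_nonneg hε₀.le (hf0 x); linarith) hΛ
  have hMi : Integrable (fun p : ℝ × ℝ × ℝ => M p.1 * u p ^ 2) := by
    refine hui.bdd_mul (c := Λ) (hMmeas.comp measurable_fst).aestronglyMeasurable
      (Eventually.of_forall fun p => ?_)
    rw [Real.norm_of_nonneg (hM0 _)]
    exact hM1 _
  have hgi : Integrable (fun p : ℝ × ℝ × ℝ => (Λ - M p.1) * u p ^ 2) := by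
    have := (hui.const_mul Λ).sub hMi
    refine this.congr (Eventually.of_forall fun p => ?_)
    simp only [Pi.sub_apply]
    ring
  have main : 0 ≤ ∫ p : ℝ × ℝ × ℝ,
      (ε * (deriv (fun t => u (t, p.2)) p.1) ^ 2 - (Λ - M p.1) * u p ^ 2) := by
    have hint : Integrable (fun p : ℝ × ℝ × ℝ =>
        (ε * (deriv (fun t => u (t, p.2)) p.1) ^ 2 - (Λ - M p.1) * u p ^ 2)) := by
      simp only [d1]
      exact ((di _).const_mul ε).sub hgi
    rw [Measure.volume_eq_prod] at hint ⊢
    rw [integral_prod_symm _ hint]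
    refine integral_nonneg fun y => ?_
    simp only [Pi.zero_apply]
    have hvC : ContDiff ℝ 1 (fun t => u (t, y)) := hu.comp (contDiff_id.prodMk contDiff_const)
    have hsub : tsupport (fun t => u (t, y)) ⊆ (fun t : ℝ => (t, y)) ⁻¹' tsupport u :=
      tsupport_comp_subset_preimage u (by fun_prop)
    have hvc : HasCompactSupport (fun t => u (t, y)) := by
      refine HasCompactSupport.intro (IsCompact.image husupp continuous_fst) fun x hx => ?_
      refine image_eq_zero_of_notMem_tsupport fun h => hx ⟨_, h, rfl⟩
    refine one (Complex.arg ⟨y.1, y.2⟩) (fun x => Λ - M x) (fun t => u (t, y)) hvC hvc ?_ ?_ ?_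
    · intro x hx
      have h := huΩ (hsub hx)
      rw [hΩ] at h
      obtain ⟨q, ⟨-, hq⟩, he⟩ := h
      have hq1 : 0 < q.2.1 := hω_half hq
      simp only [Prod.mk.injEq] at he
      obtain ⟨e1, e2⟩ := he
      rw [e1] at e2
      have e3 : q.2.1 * Real.cos (θ x) + q.2.2 * Real.sin (θ x) = y.1 := by rw [← e2]
      have e4 : q.2.2 * Real.cos (θ x) - q.2.1 * Real.sin (θ x) = y.2 := by rw [← e2]
      have c1 := Complex.norm_mul_cos_arg ⟨y.1, y.2⟩
      have c2 := Complex.norm_mul_sin_arg ⟨y.1, y.2⟩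
      simp only at c1 c2
      have hr := norm_nonneg (⟨y.1, y.2⟩ : ℂ)
      generalize ‖(⟨y.1, y.2⟩ : ℂ)‖ = r at *
      generalize Complex.arg ⟨y.1, y.2⟩ = φ at *
      have : r * Real.cos (θ x + φ) = q.2.1 := by
        rw [Real.cos_add]
        have hs := Real.sin_sq_add_cos_sq (θ x)
        linear_combination Real.cos (θ x) * c1 - Real.sin (θ x) * c2 - Real.cos (θ x) * e3
          + Real.sin (θ x) * e4 + q.2.1 * hs
      rw [← this] at hq1
      exact pos_of_mul_pos_right hq1 hr
    · intro x
      have : -(ε * f x - Λ) ≤ M x := le_max_left _ _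
      linarith
    · have hc : Integrable (fun x => u (x, y) ^ 2) := by
        refine (hvC.continuous.pow 2).integrable_of_hasCompactSupport
          (HasCompactSupport.intro hvc fun x hx => ?_)
        have := image_eq_zero_of_notMem_tsupport hx
        simp [this]
      refine hc.bdd_mul (c := Λ) (measurable_const.sub hMmeas).aestronglyMeasurable
        (Eventually.of_forall fun x => ?_)
      rw [Real.norm_of_nonneg (by have := hM1 x; linarith)]
      have := hM0 x
      linarith
  simp only [d1, d2, d3] at main ⊢
  have hGi := ((di (1, 0, 0)).add (di (0, 1, 0))).add (di (0, 0, 1))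
  have hGi' : Integrable (fun p : ℝ × ℝ × ℝ => (fderiv ℝ u p (1, 0, 0)) ^ 2 +
      (fderiv ℝ u p (0, 1, 0)) ^ 2 + (fderiv ℝ u p (0, 0, 1)) ^ 2) := hGi
  have hmono2 := integral_mono (((di (1, 0, 0)).const_mul ε).sub hgi)
    ((hGi'.const_mul ε).sub hgi) (fun p => by
      simp only [Pi.sub_apply]
      have h2 := mul_nonneg hε₀.le (sq_nonneg (fderiv ℝ u p (0, 1, 0)))
      have h3 := mul_nonneg hε₀.le (sq_nonneg (fderiv ℝ u p (0, 0, 1)))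
      linarith)
  have e1 := main.trans hmono2
  have e2 := integral_sub (hGi'.const_mul ε) hgi
  have e3 := integral_sub (hui.const_mul Λ) hMi
  have e4 := integral_sub hGi' (hui.const_mul Λ)
  simp only [Pi.sub_apply] at e1
  rw [e2, integral_const_mul] at e1
  have e5 : ∫ p : ℝ × ℝ × ℝ, (Λ - M p.1) * u p ^ 2 =
      ∫ p : ℝ × ℝ × ℝ, (Λ * u p ^ 2 - M p.1 * u p ^ 2) := by
    congr 1; funext p; ring
  rw [e5, e3] at e1
  rw [e4]
  change _ - (∫ p : ℝ × ℝ × ℝ, M p.1 * u p ^ 2) ≤ _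
  linarith
end

section
/- For every σ ≥ 0 and every ε with 0 < ε < 1, there exists a constant K ≥ 0 such that for all Λ ≥ 0: |∫_ℝ (ε f(x₁) − Λ)₋^{σ+3/2} dx₁ − ∫_ℝ (ε θ'(x₁)² − Λ)₋^{σ+3/2} dx₁| ≤ K · Λ^{σ+3/2}. (The two-sided comparison established in the proof of Proposition 4.1, inequality (long-est) and its mirror version.) -/
open Real Set Filter MeasureTheory

lemma aux_integrable (u : ℝ → ℝ) (hu : MonotoneOn u (Ioi 0)) (hu0 : ∀ x, 0 < x → 0 ≤ u x)
    (hut : Tendsto u atTop atTop) (p ε Λ : ℝ) (hp : 0 < p) (hε : 0 < ε) (hΛ : 0 ≤ Λ) :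
    IntegrableOn (fun x => (max (-(ε * u x - Λ)) 0) ^ p) (Ioi 0) := by
  obtain ⟨N, hN⟩ := eventually_atTop.1 (hut.eventually_ge_atTop (Λ / ε))
  have hanti : AntitoneOn (fun x => (max (-(ε * u x - Λ)) 0) ^ p) (Ioi 0) := by
    intro x hx y hy hxy
    have h1 := mul_le_mul_of_nonneg_left (hu hx hy hxy) hε.le
    apply Real.rpow_le_rpow (le_max_right _ _) _ hp.le
    exact max_le_max (by linarith) le_rfl
  have hI : IntegrableOn (fun x => (max (-(ε * u x - Λ)) 0) ^ p) (Ioc 0 N) := by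
    apply IntegrableOn.of_bound (C := Λ ^ p) (by simp)
    · exact (aemeasurable_restrict_of_antitoneOn measurableSet_Ioc
        (hanti.mono Ioc_subset_Ioi_self)).aestronglyMeasurable
    · filter_upwards [ae_restrict_mem measurableSet_Ioc] with x hx
      rw [Real.norm_of_nonneg (Real.rpow_nonneg (le_max_right _ _) _)]
      apply Real.rpow_le_rpow (le_max_right _ _) _ hp.le
      have := mul_nonneg hε.le (hu0 x hx.1)
      exact max_le (by linarith) hΛ
  apply hI.of_forall_sdiff_eq_zero measurableSet_Ioi
  intro x hx
  have hxN : N ≤ x := by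
    by_contra h
    exact hx.2 ⟨hx.1, (not_le.1 h).le⟩
  have h2 := hN x hxN
  rw [div_le_iff₀ hε] at h2
  rw [max_eq_right (by linarith), Real.zero_rpow hp.ne']

lemma aux_half (θ θ' : ℝ → ℝ)
    (hθ : ∀ x, HasDerivAt θ (θ' x) x)
    (hmono : Monotone θ')
    (hpos : ∀ x, 0 ≤ x → 0 ≤ θ' x)
    (hinf : Tendsto θ' atTop atTop)
    (q : ℝ → ℝ)
    (hq : ∀ α, θ 0 ≤ α →
      0 ≤ q α ∧ θ (q α) = α ∧ ∀ z, 0 ≤ z → θ z = α → q α ≤ z)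
    (f : ℝ → ℝ)
    (hf₁ : ∀ x, q (θ 0 + 2 * π) ≤ x → f x = (θ' (q (θ x - π))) ^ 2)
    (hf₃ : ∀ x, 0 < x → x < q (θ 0 + 2 * π) → f x = 0)
    (p ε : ℝ) (hp : 0 < p) (hε : 0 < ε) :
    ∃ K : ℝ, 0 ≤ K ∧ ∀ Λ : ℝ, 0 ≤ Λ →
      IntegrableOn (fun x => (max (-(ε * f x - Λ)) 0) ^ p) (Ioi 0) ∧
      IntegrableOn (fun x => (max (-(ε * (θ' x) ^ 2 - Λ)) 0) ^ p) (Ioi 0) ∧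
      |(∫ x in Ioi (0:ℝ), (max (-(ε * f x - Λ)) 0) ^ p) -
        ∫ x in Ioi (0:ℝ), (max (-(ε * (θ' x) ^ 2 - Λ)) 0) ^ p| ≤ K * Λ ^ p := by
  have hpi := Real.pi_pos
  have mvt : ∀ a b, a < b → ∃ c ∈ Ioo a b, θ b - θ a = θ' c * (b - a) := by
    intro a b hab
    obtain ⟨c, hc, h⟩ := exists_hasDerivAt_eq_slope θ θ' hab
      (fun x _ => (hθ x).continuousAt.continuousWithinAt) (fun x _ => hθ x)
    refine ⟨c, hc, ?_⟩
    rw [h, div_mul_cancel₀ _ (by linarith)]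
  have hθm : ∀ a b, 0 ≤ a → a ≤ b → θ a ≤ θ b := by
    intro a b ha hab
    rcases hab.eq_or_lt with h | h
    · rw [h]
    · obtain ⟨c, hc, h1⟩ := mvt a b h
      have := mul_nonneg (hpos c (by linarith [hc.1])) (by linarith : 0 ≤ b - a)
      linarith
  have hqm : ∀ a b, θ 0 ≤ a → a ≤ b → q a ≤ q b := by
    intro a b ha hab
    by_contra h
    push Not at h
    obtain ⟨a1, a2, a3⟩ := hq a ha
    obtain ⟨b1, b2, b3⟩ := hq b (ha.trans hab)
    have := hθm _ _ b1 h.le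
    rw [a2, b2] at this
    have e : a = b := le_antisymm hab this
    rw [e] at h
    exact lt_irrefl _ h
  set R := q (θ 0 + 2 * π) with hR
  obtain ⟨R1, R2, R3⟩ := hq (θ 0 + 2 * π) (by linarith)
  rw [← hR] at R1 R2 R3
  obtain ⟨S1, S2, S3⟩ := hq (θ 0 + π) (by linarith)
  set S := q (θ 0 + π) with hS
  have hSpos : 0 < S := by
    rcases S1.eq_or_lt with h | h
    · rw [← h] at S2
      linarith
    · exact h
  have hc : 0 < θ' S := by
    obtain ⟨c, hc, h⟩ := mvt 0 S hSpos
    rw [S2] at h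
    by_contra hn
    have h1 : θ' c ≤ 0 := (hmono hc.2.le).trans (not_lt.1 hn)
    have := mul_nonpos_of_nonpos_of_nonneg h1 (by linarith : 0 ≤ S - 0)
    linarith
  set d := π / θ' S with hd
  have hdpos : 0 < d := div_pos hpi hc
  have hy : ∀ x, R ≤ x → S ≤ q (θ x - π) ∧ q (θ x - π) ≤ x ∧ x - d ≤ q (θ x - π) := by
    intro x hx
    have hx1 := hθm _ _ R1 hx
    rw [R2] at hx1
    obtain ⟨a1, a2, a3⟩ := hq (θ x - π) (by linarith)
    have b1 : S ≤ q (θ x - π) := hqm _ _ (by linarith) (by linarith)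
    have b2 : q (θ x - π) < x := by
      by_contra h
      have := hθm x _ (R1.trans hx) (not_lt.1 h)
      linarith
    refine ⟨b1, b2.le, ?_⟩
    obtain ⟨c, hc1, h⟩ := mvt _ _ b2
    rw [a2] at h
    have h1 : θ' S ≤ θ' c := hmono (b1.trans hc1.1.le)
    have h2 := mul_le_mul_of_nonneg_right h1 (by linarith : 0 ≤ x - q (θ x - π))
    have h3 : x - q (θ x - π) ≤ d := by
      rw [hd, le_div_iff₀ hc]
      linarith
    linarith
  have hf0 : ∀ x, 0 < x → 0 ≤ f x := by
    intro x hx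
    rcases lt_or_ge x R with h | h
    · rw [hf₃ x hx h]
    · rw [hf₁ x h]
      positivity
  have hfm : MonotoneOn f (Ioi 0) := by
    intro x hx y hyy hxy
    rcases lt_or_ge x R with h | h
    · rw [hf₃ x hx h]
      exact hf0 y hyy
    · rw [hf₁ x h, hf₁ y (h.trans hxy)]
      have hx1 := hθm _ _ R1 h
      rw [R2] at hx1
      have hxy' := hθm _ _ (le_of_lt hx) hxy
      apply pow_le_pow_left₀ (hpos _ (hSpos.le.trans (hy x h).1))
      exact hmono (hqm _ _ (by linarith) (by linarith))
  have hfle : ∀ x, 0 < x → f x ≤ θ' x ^ 2 := by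
    intro x hx
    rcases lt_or_ge x R with h | h
    · rw [hf₃ x hx h]
      positivity
    · rw [hf₁ x h]
      exact pow_le_pow_left₀ (hpos _ (hSpos.le.trans (hy x h).1)) (hmono (hy x h).2.1) 2
  set M := R + d with hM
  have hfge : ∀ x, M ≤ x → θ' (x - d) ^ 2 ≤ f x := by
    intro x hx
    have h : R ≤ x := by linarith
    rw [hf₁ x h]
    exact pow_le_pow_left₀ (hpos _ (by linarith)) (hmono (hy x h).2.2) 2
  have hsqt : Tendsto (fun x => θ' x ^ 2) atTop atTop :=
    (tendsto_pow_atTop two_ne_zero).comp hinf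
  have hft : Tendsto f atTop atTop := by
    have h1 : Tendsto (fun x : ℝ => x - d) atTop atTop := tendsto_atTop_add_const_right _ _ tendsto_id
    refine tendsto_atTop_mono' _ ?_ (hsqt.comp h1)
    filter_upwards [eventually_ge_atTop M] with x hx using hfge x hx
  have hsqm : MonotoneOn (fun x => θ' x ^ 2) (Ioi 0) := fun x hx y _ hxy =>
    pow_le_pow_left₀ (hpos _ (le_of_lt hx)) (hmono hxy) 2
  have hM0 : 0 < M := by linarith
  refine ⟨M, hM0.le, fun Λ hΛ => ?_⟩
  have i1 := aux_integrable f hfm hf0 hft p ε Λ hp hε hΛ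
  have i2 := aux_integrable _ hsqm (fun x _ => sq_nonneg _) hsqt p ε Λ hp hε hΛ
  refine ⟨i1, i2, ?_⟩
  have ganti : ∀ s t, s ≤ t → (max (-(ε * t - Λ)) 0) ^ p ≤ (max (-(ε * s - Λ)) 0) ^ p := by
    intro s t hst
    have h1 := mul_le_mul_of_nonneg_left hst hε.le
    apply Real.rpow_le_rpow (le_max_right _ _) _ hp.le
    exact max_le_max (by linarith) le_rfl
  have gle : ∀ s, 0 ≤ s → (max (-(ε * s - Λ)) 0) ^ p ≤ Λ ^ p := by
    intro s hs
    have h1 := mul_nonneg hε.le hs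
    apply Real.rpow_le_rpow (le_max_right _ _) _ hp.le
    exact max_le (by linarith) hΛ
  have g0 : ∀ s, 0 ≤ (max (-(ε * s - Λ)) 0) ^ p :=
    fun s => Real.rpow_nonneg (le_max_right _ _) _
  have low : (∫ x in Ioi (0:ℝ), (max (-(ε * (θ' x) ^ 2 - Λ)) 0) ^ p) ≤
      ∫ x in Ioi (0:ℝ), (max (-(ε * f x - Λ)) 0) ^ p :=
    setIntegral_mono_on i2 i1 measurableSet_Ioi (fun x hx => ganti _ _ (hfle x hx))
  have hun : Ioc 0 M ∪ Ioi M = Ioi 0 := Ioc_union_Ioi_eq_Ioi hM0.le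
  have hsplit := setIntegral_union (μ := volume) (f := fun x => (max (-(ε * f x - Λ)) 0) ^ p)
    (Ioc_disjoint_Ioi (le_refl M) : Disjoint (Ioc 0 M) (Ioi M)) measurableSet_Ioi
    (i1.mono_set Ioc_subset_Ioi_self) (i1.mono_set (Ioi_subset_Ioi hM0.le))
  rw [hun] at hsplit
  have p1 : (∫ x in Ioc 0 M, (max (-(ε * f x - Λ)) 0) ^ p) ≤ M * Λ ^ p := by
    have h := setIntegral_mono_on (μ := volume) (i1.mono_set (Ioc_subset_Ioi_self : Ioc 0 M ⊆ Ioi 0))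
      (integrableOn_const (C := Λ ^ p) (by simp)) measurableSet_Ioc
      (fun x hx => gle _ (hf0 x hx.1))
    simpa [hM0.le] using h
  have mp := measurePreserving_sub_right (volume : Measure ℝ) d
  have me : MeasurableEmbedding (fun x : ℝ => x - d) := measurableEmbedding_subRight d
  have hpre : (fun x : ℝ => x - d) ⁻¹' (Ioi R) = Ioi M := by
    rw [hM]
    exact Set.preimage_sub_const_Ioi _ _
  have i3 := (mp.integrableOn_comp_preimage me).2 (i2.mono_set (Ioi_subset_Ioi R1))
  have e3 := mp.setIntegral_preimage_emb me
    (fun x => (max (-(ε * (θ' x) ^ 2 - Λ)) 0) ^ p) (Ioi R)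
  rw [hpre] at i3 e3
  have p2 : (∫ x in Ioi M, (max (-(ε * f x - Λ)) 0) ^ p) ≤
      ∫ x in Ioi M, (max (-(ε * (θ' (x - d)) ^ 2 - Λ)) 0) ^ p :=
    setIntegral_mono_on (i1.mono_set (Ioi_subset_Ioi hM0.le)) i3 measurableSet_Ioi
      (fun x hx => ganti _ _ (hfge x (le_of_lt hx)))
  have p3 : (∫ x in Ioi R, (max (-(ε * (θ' x) ^ 2 - Λ)) 0) ^ p) ≤
      ∫ x in Ioi 0, (max (-(ε * (θ' x) ^ 2 - Λ)) 0) ^ p :=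
    setIntegral_mono_set i2 (Eventually.of_forall fun x => g0 _)
      (Ioi_subset_Ioi R1).eventuallyLE
  rw [abs_le]
  have : 0 ≤ M * Λ ^ p := mul_nonneg hM0.le (Real.rpow_nonneg hΛ _)
  constructor <;> linarith

/-- The two-sided comparison (long-est) and its mirror version from the proof of
Proposition 4.1: for every `σ ≥ 0` and `0 < ε < 1` there is a constant `K ≥ 0` such that for
all `Λ ≥ 0` the integrals `∫_ℝ (ε f(x₁) − Λ)₋^{σ+3/2} dx₁` and
`∫_ℝ (ε θ'(x₁)² − Λ)₋^{σ+3/2} dx₁` differ by at most `K · Λ^{σ+3/2}`. -/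
theorem integral_comparison (θ θ' : ℝ → ℝ)
    (hθ : ∀ x, HasDerivAt θ (θ' x) x) (hθ'c : Continuous θ')
    (hmono : Monotone θ')
    (hpos : ∀ x, 0 ≤ x → 0 ≤ θ' x) (hneg : ∀ x, x ≤ 0 → θ' x ≤ 0)
    (hinf : Tendsto (fun x => |θ' x|) (cocompact ℝ) atTop)
    (θinvp θinvm : ℝ → ℝ)
    (hinvp : ∀ α, θ 0 ≤ α →
      0 ≤ θinvp α ∧ θ (θinvp α) = α ∧ ∀ z, 0 ≤ z → θ z = α → θinvp α ≤ z)
    (hinvm : ∀ α, θ 0 ≤ α →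
      θinvm α ≤ 0 ∧ θ (θinvm α) = α ∧ ∀ z, z ≤ 0 → θ z = α → z ≤ θinvm α)
    (f : ℝ → ℝ)
    (hf₁ : ∀ x, θinvp (θ 0 + 2 * π) ≤ x → f x = (θ' (θinvp (θ x - π))) ^ 2)
    (hf₂ : ∀ x, x ≤ θinvm (θ 0 + 2 * π) → f x = (θ' (θinvm (θ x - π))) ^ 2)
    (hf₃ : ∀ x, θinvm (θ 0 + 2 * π) < x → x < θinvp (θ 0 + 2 * π) → f x = 0)
    (σ ε : ℝ) (hσ : 0 ≤ σ) (hε₀ : 0 < ε) (hε₁ : ε < 1) :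
    ∃ K : ℝ, 0 ≤ K ∧ ∀ Λ : ℝ, 0 ≤ Λ →
      |(∫ x : ℝ, (max (-(ε * f x - Λ)) 0) ^ (σ + 3 / 2 : ℝ)) -
        ∫ x : ℝ, (max (-(ε * (θ' x) ^ 2 - Λ)) 0) ^ (σ + 3 / 2 : ℝ)| ≤
        K * Λ ^ (σ + 3 / 2 : ℝ) := by
  have hpi := Real.pi_pos
  have hp : 0 < σ + 3 / 2 := by linarith
  have hRp : 0 < θinvp (θ 0 + 2 * π) := by
    obtain ⟨h1, h2, -⟩ := hinvp (θ 0 + 2 * π) (by linarith)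
    rcases h1.eq_or_lt with h | h
    · rw [← h] at h2
      linarith
    · exact h
  have hRm : θinvm (θ 0 + 2 * π) < 0 := by
    obtain ⟨h1, h2, -⟩ := hinvm (θ 0 + 2 * π) (by linarith)
    rcases h1.eq_or_lt with h | h
    · rw [h] at h2
      linarith
    · exact h
  rw [cocompact_eq_atBot_atTop, tendsto_sup] at hinf
  obtain ⟨K₁, hK₁, H₁⟩ := aux_half θ θ' hθ hmono hpos
    (hinf.2.congr' (by
      filter_upwards [eventually_ge_atTop 0] with x hx using abs_of_nonneg (hpos x hx)))
    θinvp hinvp f hf₁ (fun x hx hxR => hf₃ x (hRm.trans hx) hxR) (σ + 3 / 2) ε hp hε₀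
  obtain ⟨K₂, hK₂, H₂⟩ := aux_half (fun x => θ (-x)) (fun x => -θ' (-x))
    (fun x => by simpa [Function.comp_def] using (hθ (-x)).comp x (hasDerivAt_neg x))
    (fun x y hxy => neg_le_neg (hmono (neg_le_neg hxy)))
    (fun x hx => neg_nonneg.2 (hneg _ (neg_nonpos.2 hx)))
    ((hinf.1.comp tendsto_neg_atTop_atBot).congr' (by
      filter_upwards [eventually_ge_atTop 0] with x hx using
        abs_of_nonpos (hneg _ (neg_nonpos.2 hx))))
    (fun α => -θinvm α)
    (fun α hα => by
      simp only [neg_zero] at hα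
      obtain ⟨h1, h2, h3⟩ := hinvm α hα
      refine ⟨by linarith, by simpa using h2, fun z hz hz2 => ?_⟩
      have := h3 (-z) (by linarith) hz2
      linarith)
    (fun x => f (-x))
    (fun x hx => by
      simp only [neg_zero] at hx
      simp only [neg_neg, neg_sq]
      exact hf₂ _ (by linarith))
    (fun x hx hxR => by
      simp only [neg_zero] at hxR
      exact hf₃ _ (by linarith) (by linarith))
    (σ + 3 / 2) ε hp hε₀
  refine ⟨K₁ + K₂, by linarith, fun Λ hΛ => ?_⟩
  obtain ⟨a1, a2, a3⟩ := H₁ Λ hΛ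
  obtain ⟨b1, b2, b3⟩ := H₂ Λ hΛ
  simp only [neg_sq] at b2 b3
  have key : ∀ φ : ℝ → ℝ, IntegrableOn φ (Ioi 0) → IntegrableOn (fun x => φ (-x)) (Ioi 0) →
      (∫ x, φ x) = (∫ x in Ioi 0, φ (-x)) + ∫ x in Ioi 0, φ x := by
    intro φ h1 h2
    have h3 : IntegrableOn φ (Iic 0) := by
      rw [integrableOn_Iic_iff_integrableOn_Iio]
      rw [← (Measure.measurePreserving_neg (volume : Measure ℝ)).integrableOn_comp_preimage
        (Homeomorph.neg ℝ).measurableEmbedding]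
      simpa [Function.comp_def] using h2
    rw [integral_comp_neg_Ioi, neg_zero, ← setIntegral_union (Iic_disjoint_Ioi le_rfl)
      measurableSet_Ioi h3 h1, Iic_union_Ioi, setIntegral_univ]
  have e1 := key (fun x => (max (-(ε * f x - Λ)) 0) ^ (σ + 3 / 2 : ℝ)) a1 b1
  have e2 := key (fun x => (max (-(ε * (θ' x) ^ 2 - Λ)) 0) ^ (σ + 3 / 2 : ℝ)) a2 b2
  rw [e1, e2]
  rw [abs_le] at a3 b3 ⊢
  constructor <;> linarith [a3.1, a3.2, b3.1, b3.2]
end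

section
/- Fix (x₂,x₃) ∈ ℝ² and set ω_x := {t ∈ ℝ : (t,x₂,x₃) ∈ Ω}. Then for every real-valued continuously differentiable function g on ℝ with compact support which vanishes at every point of ℝ \ ω_x, one has ∫_ℝ g'(t)² dt ≥ ∫_{−∞}^{θ₋⁻¹(θ(0)+2π)} (θ'(θ₋⁻¹(θ(t) − π)))² g(t)² dt. (This is the one-dimensional slice estimate (final−) in the proof of Lemma 3.1.) -/
open Real Set Filter MeasureTheory

/-- Wirtinger's inequality with a sub-optimal constant. -/
lemma wirtinger_aux (g : ℝ → ℝ) (hg : ContDiff ℝ 1 g) (a b k : ℝ) (hab : a < b)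
    (ha : g a = 0) (hb : g b = 0) (hk : 0 < k) (hkL : k * (b - a) < π) :
    k ^ 2 * (∫ t in a..b, (g t) ^ 2) ≤ ∫ t in a..b, (deriv g t) ^ 2 := by
  have hgc : Continuous g := hg.continuous
  have hg'c : Continuous (deriv g) := hg.continuous_deriv le_rfl
  have hgd : ∀ t, HasDerivAt g (deriv g t) t := fun t =>
    (hg.differentiable one_ne_zero t).hasDerivAt
  have hcos : ∀ t ∈ Icc a b, 0 < Real.cos (k * (t - (a + b) / 2)) := by
    intro t ht
    apply Real.cos_pos_of_mem_Ioo
    have h1 := mul_le_mul_of_nonneg_left ht.1 hk.le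
    have h2 := mul_le_mul_of_nonneg_left ht.2 hk.le
    constructor <;> nlinarith
  have hder : ∀ t ∈ Icc a b, HasDerivAt
      (fun t => -k * Real.tan (k * (t - (a + b) / 2)) * (g t) ^ 2)
      (-k * (1 / Real.cos (k * (t - (a + b) / 2)) ^ 2 * k) * (g t) ^ 2
        + -k * Real.tan (k * (t - (a + b) / 2)) * (2 * g t * deriv g t)) t := by
    intro t ht
    have h1 : HasDerivAt (fun t => k * (t - (a + b) / 2)) k t := by
      simpa using ((hasDerivAt_id t).sub_const ((a + b) / 2)).const_mul k
    have h2 := (((Real.hasDerivAt_tan (hcos t ht).ne').comp t h1).const_mul (-k)).mul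
      ((hgd t).pow 2)
    refine h2.congr_deriv ?_
    simp
  have key := intervalIntegral.sub_le_integral_of_hasDeriv_right_of_le (a := a) (b := b)
    (g := fun t => -k * Real.tan (k * (t - (a + b) / 2)) * (g t) ^ 2)
    (φ := fun t => (deriv g t) ^ 2 - k ^ 2 * (g t) ^ 2) hab.le
    (fun t ht => (hder t ht).continuousAt.continuousWithinAt)
    (fun t ht => (hder t (Ioo_subset_Icc_self ht)).hasDerivWithinAt)
    ((by fun_prop : Continuous fun t =>
      (deriv g t) ^ 2 - k ^ 2 * (g t) ^ 2).continuousOn.integrableOn_Icc)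
    (by
      intro t ht
      have hc := hcos t (Ioo_subset_Icc_self ht)
      have h1 : 1 / Real.cos (k * (t - (a + b) / 2)) ^ 2
          = 1 + Real.tan (k * (t - (a + b) / 2)) ^ 2 := by
        have h0 := Real.sin_sq_add_cos_sq (k * (t - (a + b) / 2))
        rw [Real.tan_eq_sin_div_cos]
        generalize k * (t - (a + b) / 2) = y at hc h0 ⊢
        field_simp
        linarith
      rw [h1]
      nlinarith [sq_nonneg (deriv g t + k * Real.tan (k * (t - (a + b) / 2)) * g t)])
  rw [intervalIntegral.integral_sub ((by fun_prop : Continuous fun t =>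
      (deriv g t) ^ 2).intervalIntegrable _ _) ((by fun_prop : Continuous fun t =>
      k ^ 2 * (g t) ^ 2).intervalIntegrable _ _), intervalIntegral.integral_const_mul] at key
  simp only [ha, hb] at key
  linarith

/-- Wirtinger's inequality. -/
lemma wirtinger_opt (g : ℝ → ℝ) (hg : ContDiff ℝ 1 g) (a b : ℝ) (hab : a < b)
    (ha : g a = 0) (hb : g b = 0) :
    (π / (b - a)) ^ 2 * (∫ t in a..b, (g t) ^ 2) ≤ ∫ t in a..b, (deriv g t) ^ 2 := by
  have hL : 0 < b - a := sub_pos.2 hab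
  have hK : 0 < π / (b - a) := div_pos Real.pi_pos hL
  have ht : Tendsto (fun k : ℝ => k ^ 2 * (∫ t in a..b, (g t) ^ 2))
      (nhdsWithin (π / (b - a)) (Iio (π / (b - a))))
      (nhds ((π / (b - a)) ^ 2 * (∫ t in a..b, (g t) ^ 2))) :=
    ((by fun_prop : Continuous fun k : ℝ => k ^ 2 * (∫ t in a..b, (g t) ^ 2)).tendsto _).mono_left
      nhdsWithin_le_nhds
  refine le_of_tendsto ht ?_
  filter_upwards [Ioo_mem_nhdsLT hK] with k hk
  exact wirtinger_aux g hg a b k hab ha hb hk.1 ((lt_div_iff₀ hL).1 hk.2)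

/-- The one-dimensional slice estimate (final−) in the proof of Lemma 3.1: for a fixed point
`(x₂,x₃)` of the plane and any continuously differentiable compactly supported `g : ℝ → ℝ`
vanishing outside the slice `ω_x = {t : (t,x₂,x₃) ∈ Ω}`, one has
`∫_ℝ g'(t)² dt ≥ ∫_{−∞}^{θ₋⁻¹(θ(0)+2π)} (θ'(θ₋⁻¹(θ(t) − π)))² g(t)² dt`. -/
theorem slice_estimate_minus
    (ω : Set (ℝ × ℝ)) (hω_ne : ω.Nonempty) (hω_bdd : Bornology.IsBounded ω)
    (hω_open : IsOpen ω) (hω_conn : IsConnected ω)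
    (hω_half : ω ⊆ {y : ℝ × ℝ | 0 < y.1})
    (θ θ' : ℝ → ℝ)
    (hθ : ∀ x, HasDerivAt θ (θ' x) x) (hθ'c : Continuous θ')
    (hmono : Monotone θ')
    (hpos : ∀ x, 0 ≤ x → 0 ≤ θ' x) (hneg : ∀ x, x ≤ 0 → θ' x ≤ 0)
    (hinf : Tendsto (fun x => |θ' x|) (cocompact ℝ) atTop)
    (Ω : Set (ℝ × ℝ × ℝ))
    (hΩ : Ω = (fun q : ℝ × ℝ × ℝ =>
      (q.1, q.2.1 * Real.cos (θ q.1) + q.2.2 * Real.sin (θ q.1),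
       q.2.2 * Real.cos (θ q.1) - q.2.1 * Real.sin (θ q.1))) '' (Set.univ ×ˢ ω))
    (θinvm : ℝ → ℝ)
    (hinvm : ∀ α, θ 0 ≤ α →
      θinvm α ≤ 0 ∧ θ (θinvm α) = α ∧ ∀ z, z ≤ 0 → θ z = α → z ≤ θinvm α)
    (x₂ x₃ : ℝ)
    (g : ℝ → ℝ) (hg : ContDiff ℝ 1 g) (hgsupp : HasCompactSupport g)
    (hgvanish : ∀ t : ℝ, (t, x₂, x₃) ∉ Ω → g t = 0) :
    ∫ t in Set.Iio (θinvm (θ 0 + 2 * π)),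
        (θ' (θinvm (θ t - π))) ^ 2 * (g t) ^ 2 ≤
      ∫ t : ℝ, (deriv g t) ^ 2 := by
  have hgc : Continuous g := hg.continuous
  have hg'c : Continuous (deriv g) := hg.continuous_deriv le_rfl
  have hD : Integrable (fun t => (deriv g t) ^ 2) := by
    have h1 : HasCompactSupport (deriv g) := hgsupp.deriv
    refine (by fun_prop : Continuous fun t => (deriv g t) ^ 2).integrable_of_hasCompactSupport ?_
    exact h1.comp_left (g := fun x : ℝ => x ^ 2) (by simp)
  by_cases hint : IntegrableOn (fun t => (θ' (θinvm (θ t - π))) ^ 2 * (g t) ^ 2)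
      (Set.Iio (θinvm (θ 0 + 2 * π)))
  swap
  · rw [integral_undef hint]
    exact integral_nonneg fun t => sq_nonneg _
  -- monotonicity
  have hanti : AntitoneOn θ (Iic 0) := by
    refine antitoneOn_of_deriv_nonpos (convex_Iic 0)
      (fun t _ => (hθ t).continuousAt.continuousWithinAt)
      (fun t _ => (hθ t).differentiableAt.differentiableWithinAt) ?_
    intro t ht
    rw [(hθ t).deriv]
    exact hneg t (mem_Iic.1 (interior_subset (s := Iic (0 : ℝ)) ht))
  have hinv_anti : ∀ α β, θ 0 ≤ α → α ≤ β → θinvm β ≤ θinvm α := by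
    intro α β hα hαβ
    obtain ⟨h1, h2, -⟩ := hinvm α hα
    obtain ⟨h4, h5, -⟩ := hinvm β (hα.trans hαβ)
    by_contra! hlt
    have h7 := hanti (mem_Iic.2 h1) (mem_Iic.2 h4) hlt.le
    rw [h2, h5] at h7
    have : α = β := le_antisymm hαβ h7
    subst this
    exact lt_irrefl _ hlt
  -- the zero
  obtain ⟨β, hβ, hβ0⟩ : ∃ β ∈ Icc (θ 0 + π) (θ 0 + 2 * π),
      x₂ * Real.cos β - x₃ * Real.sin β = 0 := by
    have hc : Continuous fun s : ℝ => x₂ * Real.cos s - x₃ * Real.sin s := by fun_prop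
    have hle : θ 0 + π ≤ θ 0 + 2 * π := by linarith [Real.pi_pos]
    have e : θ 0 + 2 * π = (θ 0 + π) + π := by ring
    have hv : x₂ * Real.cos (θ 0 + 2 * π) - x₃ * Real.sin (θ 0 + 2 * π)
        = -(x₂ * Real.cos (θ 0 + π) - x₃ * Real.sin (θ 0 + π)) := by
      rw [e, Real.cos_add_pi, Real.sin_add_pi]; ring
    rcases le_total (x₂ * Real.cos (θ 0 + π) - x₃ * Real.sin (θ 0 + π)) 0 with h | h
    · exact intermediate_value_Icc hle hc.continuousOn ⟨h, by simp only [hv]; linarith⟩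
    · exact intermediate_value_Icc' hle hc.continuousOn ⟨by simp only [hv]; linarith, h⟩
  have hβn : ∀ n : ℕ, x₂ * Real.cos (β + n * π) - x₃ * Real.sin (β + n * π) = 0 := by
    intro n
    rw [Real.cos_add_nat_mul_pi, Real.sin_add_nat_mul_pi]
    linear_combination (-1) ^ n * hβ0
  have hβge : ∀ n : ℕ, θ 0 + π ≤ β + n * π := fun n => by
    have : 0 ≤ (n : ℝ) * π := by positivity
    linarith [hβ.1]
  have hβge' : ∀ n : ℕ, θ 0 ≤ β + n * π := fun n => by linarith [hβge n, Real.pi_pos]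
  set z : ℕ → ℝ := fun n => θinvm (β + n * π) with hz
  have hz0 : ∀ n, z n ≤ 0 := fun n => (hinvm _ (hβge' n)).1
  have hθz : ∀ n, θ (z n) = β + n * π := fun n => (hinvm _ (hβge' n)).2.1
  have hgz : ∀ n, g (z n) = 0 := by
    intro n
    apply hgvanish
    rw [hΩ]
    rintro ⟨⟨s, a, b⟩, ⟨-, hab⟩, heq⟩
    simp only [Prod.mk.injEq] at heq
    obtain ⟨h1, h2, h3⟩ := heq
    have ha : 0 < a := hω_half hab
    subst h1
    have h4 := hβn n
    rw [← hθz n, ← h2, ← h3] at h4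
    have h5 : a * (Real.sin (θ (z n)) ^ 2 + Real.cos (θ (z n)) ^ 2) = 0 := by
      linear_combination h4
    rw [Real.sin_sq_add_cos_sq] at h5
    linarith
  have hzlt : ∀ n, z (n + 1) < z n := by
    intro n
    refine lt_of_le_of_ne (hinv_anti _ _ (hβge' n) ?_) ?_
    · push_cast; linarith [Real.pi_pos]
    · intro h
      have h1 := hθz (n + 1)
      rw [h, hθz n] at h1
      push_cast at h1
      linarith [Real.pi_pos]
  have hTz : θinvm (θ 0 + 2 * π) ≤ z 0 := by
    apply hinv_anti _ _ (hβge' 0)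
    simpa using hβ.2
  have hza : Antitone z := antitone_nat_of_succ_le fun n => (hzlt n).le
  set T := θinvm (θ 0 + 2 * π) with hT
  set f : ℝ → ℝ := (Iio T).indicator (fun t => (θ' (θinvm (θ t - π))) ^ 2 * (g t) ^ 2) with hf
  have hfint : Integrable f := (integrable_indicator_iff measurableSet_Iio).2 hint
  have hpiece : ∀ n, ∫ t in (z (n + 1))..(z n), f t ≤ ∫ t in (z (n + 1))..(z n), (deriv g t) ^ 2 := by
    intro n
    refine le_trans ?_ (wirtinger_opt g hg _ _ (hzlt n) (hgz _) (hgz _))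
    rw [← intervalIntegral.integral_const_mul]
    refine intervalIntegral.integral_mono_on (hzlt n).le hfint.intervalIntegrable
      ((by fun_prop : Continuous fun t => (π / (z n - z (n + 1))) ^ 2 * (g t) ^ 2).intervalIntegrable
        _ _) ?_
    intro t ht
    have hL : 0 < z n - z (n + 1) := sub_pos.2 (hzlt n)
    have hnn : 0 ≤ (π / (z n - z (n + 1))) ^ 2 * (g t) ^ 2 := by positivity
    refine Set.indicator_apply_le' (fun _ => ?_) (fun _ => hnn)
    refine mul_le_mul_of_nonneg_right ?_ (sq_nonneg _)
    have ht0 : t ≤ 0 := ht.2.trans (hz0 n)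
    have h1 : θ t ≤ β + n * π + π := by
      have := hanti (mem_Iic.2 (hz0 (n + 1))) (mem_Iic.2 ht0) ht.1
      rw [hθz] at this
      push_cast at this
      linarith
    have h2 : β + n * π ≤ θ t := by
      have := hanti (mem_Iic.2 ht0) (mem_Iic.2 (hz0 n)) ht.2
      rwa [hθz] at this
    have hu0 : θ 0 ≤ θ t - π := by linarith [hβge n]
    have hu : z n ≤ θinvm (θ t - π) := hinv_anti _ _ hu0 (by linarith)
    obtain ⟨c, hc, hc'⟩ := exists_hasDerivAt_eq_slope θ θ' (hzlt n)
      (fun t _ => (hθ t).continuousAt.continuousWithinAt) (fun t _ => hθ t)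
    rw [hθz, hθz] at hc'
    have h3 : θ' c = -(π / (z n - z (n + 1))) := by
      rw [hc']; push_cast; ring
    have h4 : θ' c ≤ θ' (θinvm (θ t - π)) := hmono (hc.2.le.trans hu)
    have h5 := hneg _ (hinvm _ hu0).1
    apply sq_le_sq'
    · linarith
    · have : 0 < π / (z n - z (n + 1)) := div_pos Real.pi_pos hL
      linarith
  have hsum : ∀ n, ∫ t in (z n)..(z 0), f t ≤ ∫ t in (z n)..(z 0), (deriv g t) ^ 2 := by
    intro n
    induction n with
    | zero => simp
    | succ n ih =>
      rw [← intervalIntegral.integral_add_adjacent_intervals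
          (hfint.intervalIntegrable (a := z (n + 1)) (b := z n)) hfint.intervalIntegrable,
        ← intervalIntegral.integral_add_adjacent_intervals
          (hD.intervalIntegrable (a := z (n + 1)) (b := z n)) hD.intervalIntegrable]
      exact add_le_add (hpiece n) ih
  -- choose N
  obtain ⟨M, hM⟩ : ∃ M : ℝ, M ≤ 0 ∧ ∀ t, t < M → g t = 0 := by
    obtain ⟨m, hm⟩ := hgsupp.isCompact.bddBelow
    refine ⟨min m 0, min_le_right _ _, fun t ht => ?_⟩
    by_contra hne
    have := hm (subset_tsupport g (Function.mem_support.2 hne))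
    exact absurd (ht.trans_le (min_le_left _ _)) (not_lt.2 this)
  obtain ⟨N, hN⟩ : ∃ N : ℕ, θ M < β + N * π := by
    obtain ⟨N, hN⟩ := exists_nat_gt ((θ M - β) / π)
    refine ⟨N, ?_⟩
    rw [div_lt_iff₀ Real.pi_pos] at hN
    linarith
  have hzN : z N ≤ M := by
    by_contra! h
    have := hanti (mem_Iic.2 hM.1) (mem_Iic.2 (hz0 N)) h.le
    rw [hθz] at this
    linarith
  have hN0 : z N ≤ z 0 := hza (Nat.zero_le N)
  have hfeq : ∫ t in Set.Iio T, (θ' (θinvm (θ t - π))) ^ 2 * (g t) ^ 2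
      = ∫ t in (z N)..(z 0), f t := by
    rw [← integral_indicator measurableSet_Iio, intervalIntegral.integral_of_le hN0]
    symm
    apply setIntegral_eq_integral_of_forall_compl_eq_zero
    intro t ht
    by_cases htT : t ∈ Iio T
    · have h1 : t ≤ z N := by
        by_contra! h
        exact ht ⟨h, (mem_Iio.1 htT).le.trans hTz⟩
      have h2 : g t = 0 := by
        rcases h1.lt_or_eq with h | h
        · exact hM.2 t (h.trans_le hzN)
        · rw [h]; exact hgz N
      simp [hf, h2, Set.indicator]
    · simp [hf, htT]
  rw [hfeq]
  refine (hsum N).trans ?_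
  rw [intervalIntegral.integral_of_le hN0]
  exact setIntegral_le_integral hD (Eventually.of_forall fun t => sq_nonneg _)
end
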